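/- Let S be continuous on D with at most finitely many zeros, and suppose the sum function γ(x,y) = Σ_{w∈Σ}|S(L_w(x,y))| satisfies γ_* = min_D γ ≥ 1. Then there exists n₀ ∈ ℤ⁺ such that the lower vertical scaling matrix M̲_n is primitive for all n > n₀. -/

import Mathlib

open scoped BigOperators

noncomputable def oscil (φ : ℝ × ℝ → ℝ) (E : Set (ℝ × ℝ)) : ℝ :=
  sSup ((fun p : (ℝ × ℝ) × (ℝ × ℝ) => φ p.1 - φ p.2) '' (E ×ˢ E))

noncomputable def eudist (s t : ℝ × ℝ) : ℝ :=
  Real.sqrt ((s.1 - t.1) ^ 2 + (s.2 - t.2) ^ 2)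

noncomputable def uMap (x0 len : ℝ) (N : ℕ) (i : Fin N) (x : ℝ) : ℝ :=
  if i.val % 2 = 0 then x0 + i.val * (len / N) + (x - x0) / N
  else x0 + (i.val + 1) * (len / N) - (x - x0) / N

noncomputable def uInv (x0 len : ℝ) (N : ℕ) (i : Fin N) (y : ℝ) : ℝ :=
  if i.val % 2 = 0 then x0 + N * (y - (x0 + i.val * (len / N)))
  else x0 + N * ((x0 + (i.val + 1) * (len / N)) - y)

noncomputable def Lmap (x0 y0 len : ℝ) (N : ℕ) (w : Fin N × Fin N) (t : ℝ × ℝ) : ℝ × ℝ :=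
  (uMap x0 len N w.1 t.1, uMap y0 len N w.2 t.2)

noncomputable def LInv (x0 y0 len : ℝ) (N : ℕ) (w : Fin N × Fin N) (t : ℝ × ℝ) : ℝ × ℝ :=
  (uInv x0 len N w.1 t.1, uInv y0 len N w.2 t.2)

noncomputable def sqD (x0 y0 len : ℝ) : Set (ℝ × ℝ) :=
  Set.Icc x0 (x0 + len) ×ˢ Set.Icc y0 (y0 + len)

noncomputable def cell (x0 y0 len : ℝ) (N : ℕ) : List (Fin N × Fin N) → Set (ℝ × ℝ)
  | [] => sqD x0 y0 len
  | w :: ws => Lmap x0 y0 len N w '' cell x0 y0 len N ws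

noncomputable def oscSum (x0 y0 len : ℝ) (N : ℕ) (φ : ℝ × ℝ → ℝ)
    (p : List (Fin N × Fin N)) (k : ℕ) : ℝ :=
  ∑ w : Fin k → Fin N × Fin N, oscil φ (cell x0 y0 len N (p ++ List.ofFn w))

noncomputable def supAbs (S : ℝ × ℝ → ℝ) (E : Set (ℝ × ℝ)) : ℝ :=
  sSup ((fun t => |S t|) '' E)

noncomputable def infAbs (S : ℝ × ℝ → ℝ) (E : Set (ℝ × ℝ)) : ℝ :=
  sInf ((fun t => |S t|) '' E)

open Classical in
noncomputable def upMat (x0 y0 len : ℝ) (N : ℕ) (S : ℝ × ℝ → ℝ) (m : ℕ) :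
    Matrix (Fin (m + 1) → Fin N × Fin N) (Fin (m + 1) → Fin N × Fin N) ℝ :=
  fun i j =>
    if ∀ k : Fin m, i k.succ = j k.castSucc then
      supAbs S (cell x0 y0 len N (List.ofFn i ++ [j (Fin.last m)]))
    else 0

open Classical in
noncomputable def lowMat (x0 y0 len : ℝ) (N : ℕ) (S : ℝ × ℝ → ℝ) (m : ℕ) :
    Matrix (Fin (m + 1) → Fin N × Fin N) (Fin (m + 1) → Fin N × Fin N) ℝ :=
  fun i j =>
    if ∀ k : Fin m, i k.succ = j k.castSucc then
      infAbs S (cell x0 y0 len N (List.ofFn i ++ [j (Fin.last m)]))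
    else 0

def MatPrimitive {α : Type*} [Fintype α] [DecidableEq α] (A : Matrix α α ℝ) : Prop :=
  ∃ k : ℕ, 0 < k ∧ ∀ i j, 0 < (A ^ k) i j

section Words

variable {σ : Type*}

/-- No word of `F` occurs as a factor of `l`. -/
def Avoids (F : Finset (List σ)) (l : List σ) : Prop := ∀ f ∈ F, ¬ f <:+: l

lemma avoids_of_length_le {F : Finset (List σ)} {n : ℕ} (hF : ∀ f ∈ F, f.length = n + 1)
    {l : List σ} (hl : l.length ≤ n) : Avoids F l := by
  intro f hf h
  have := h.length_le
  have := hF f hf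
  omega

lemma Avoids.concat {F : Finset (List σ)} {n : ℕ} (hF : ∀ f ∈ F, f.length = n + 1)
    {l x : List σ} {a : σ} (hl : Avoids F l) (hx : x.length = n) (hxl : x <:+ l)
    (hxa : x ++ [a] ∉ F) : Avoids F (l ++ [a]) := by
  intro f hf h
  rcases List.infix_concat_iff.1 h with h | h
  · obtain ⟨s, rfl⟩ := hxl
    have h2 : x ++ [a] <:+ s ++ x ++ [a] := ⟨s, by simp⟩
    have := List.suffix_of_suffix_length_le h h2 (by simp [hF f hf, hx])
    have := this.eq_of_length (by simp [hF f hf, hx])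
    exact hxa (this ▸ hf)
  · exact hl f hf h

lemma exists_suffix_length {l : List σ} {n : ℕ} (h : n ≤ l.length) :
    ∃ x, x <:+ l ∧ x.length = n :=
  ⟨l.drop (l.length - n), List.drop_suffix _ _, by simp; omega⟩

lemma infix_append_cases {f s t : List σ} (h : f <:+: s ++ t) :
    f <:+: s ∨ ∃ f₁ f₂, f = f₁ ++ f₂ ∧ f₂ ≠ [] ∧ f₁ <:+ s ∧ (f₂ <+: t ∨ f <:+: t) := by
  rcases List.infix_append_iff.1 h with h | h | ⟨f₁, f₂, rfl, h1, h2⟩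
  · exact Or.inl h
  · by_cases hf : f = []
    · exact Or.inl (hf ▸ List.nil_infix)
    · exact Or.inr ⟨[], f, rfl, hf, List.nil_suffix, Or.inr h⟩
  · by_cases hf : f₂ = []
    · exact Or.inl (by simpa [hf] using h1.isInfix)
    · exact Or.inr ⟨f₁, f₂, rfl, hf, h1, Or.inl h2⟩

lemma avoids_image_reverse [DecidableEq σ] {F : Finset (List σ)} {l : List σ} :
    Avoids (F.image List.reverse) l.reverse ↔ Avoids F l := by
  simp [Avoids, List.reverse_infix]

variable [DecidableEq σ]

lemma exists_many_extensions {F : Finset (List σ)} {n : ℕ} (hF : ∀ f ∈ F, f.length = n + 1)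
    (hR : ∀ x : List σ, x.length = n → ∃ a b, a ≠ b ∧ x ++ [a] ∉ F ∧ x ++ [b] ∉ F)
    {i : List σ} (hi : i.length = n) (c : ℕ) :
    ∃ W : Finset (List σ), 2 ^ c ≤ W.card ∧ ∀ u ∈ W, u.length = c ∧ Avoids F (i ++ u) := by
  induction c with
  | zero =>
    refine ⟨{[]}, by simp, ?_⟩
    simp only [Finset.mem_singleton, forall_eq, List.length_nil, List.append_nil, true_and]
    exact avoids_of_length_le hF hi.le
  | succ c ih =>
    obtain ⟨W, hW, h⟩ := ih
    have key : ∀ u : List σ, ∃ a b, a ≠ b ∧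
        (u ∈ W → Avoids F (i ++ (u ++ [a])) ∧ Avoids F (i ++ (u ++ [b]))) := by
      intro u
      obtain ⟨x, hx, hxn⟩ := exists_suffix_length (l := i ++ u) (n := n) (by simp [hi])
      obtain ⟨a, b, hab, ha, hb⟩ := hR x hxn
      refine ⟨a, b, hab, fun hu => ?_⟩
      simp only [← List.append_assoc]
      exact ⟨(h u hu).2.concat hF hxn hx ha, (h u hu).2.concat hF hxn hx hb⟩
    choose a b hab hav using key
    refine ⟨W.image (fun u => u ++ [a u]) ∪ W.image (fun u => u ++ [b u]), ?_, ?_⟩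
    · rw [Finset.card_union_of_disjoint, Finset.card_image_of_injective,
        Finset.card_image_of_injective]
      · rw [pow_succ]; omega
      · intro u v huv; exact (List.append_inj' huv rfl).1
      · intro u v huv; exact (List.append_inj' huv rfl).1
      · rw [Finset.disjoint_left]
        intro w hw hw'
        simp only [Finset.mem_image] at hw hw'
        obtain ⟨u, -, rfl⟩ := hw
        obtain ⟨v, -, hv⟩ := hw'
        obtain ⟨rfl, h2⟩ := List.append_inj' hv rfl
        exact hab v (List.singleton_injective h2).symm
    · intro w hw
      simp only [Finset.mem_union, Finset.mem_image] at hw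
      rcases hw with ⟨u, hu, rfl⟩ | ⟨u, hu, rfl⟩
      · exact ⟨by simp [(h u hu).1], (hav u hu).1⟩
      · exact ⟨by simp [(h u hu).1], (hav u hu).2⟩

/-- A word of length `n` can be extended by `c` letters so that long prefixes of forbidden words
are no longer suffixes of it. -/
lemma exists_free_extension {F : Finset (List σ)} {n r c : ℕ} (hF : ∀ f ∈ F, f.length = n + 1)
    (hc : F.card * r < 2 ^ c) (hn : r + c ≤ n)
    (hR : ∀ x : List σ, x.length = n → ∃ a b, a ≠ b ∧ x ++ [a] ∉ F ∧ x ++ [b] ∉ F)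
    {i : List σ} (hi : i.length = n) :
    ∃ u : List σ, u.length = c ∧ Avoids F (i ++ u) ∧
      ∀ f ∈ F, ∀ L, 1 ≤ L → L ≤ r → ¬ f.take (n + 1 - L) <:+ i ++ u := by
  obtain ⟨W, hW, h⟩ := exists_many_extensions hF hR hi c
  let B : Finset (List σ) :=
    (F ×ˢ Finset.Icc 1 r).image fun p => (p.1.take (n + 1 - p.2)).drop (n + 1 - p.2 - c)
  have hB : B.card < W.card :=
    calc B.card ≤ F.card * r := by
          refine Finset.card_image_le.trans ?_
          simp
      _ < W.card := hc.trans_le hW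
  obtain ⟨u, hu, huB⟩ := Finset.exists_mem_notMem_of_card_lt_card hB
  refine ⟨u, (h u hu).1, (h u hu).2, fun f hf L h1 h2 hs => huB ?_⟩
  refine Finset.mem_image.2 ⟨(f, L), by simp [hf, h1, h2], ?_⟩
  have hfl := hF f hf
  have hs2 : (f.take (n + 1 - L)).drop (n + 1 - L - c) <:+ i ++ u :=
    (List.drop_suffix _ _).trans hs
  have hlen : ((f.take (n + 1 - L)).drop (n + 1 - L - c)).length = u.length := by
    simp only [List.length_drop, List.length_take, hfl, (h u hu).1]; omega
  exact (List.suffix_of_suffix_length_le hs2 (List.suffix_append i u) hlen.le).eq_of_length hlen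

variable [Fintype σ]

/-- The finite set of words of length `n` over a finite alphabet. -/
def words (σ : Type*) [Fintype σ] [DecidableEq σ] (n : ℕ) : Finset (List σ) :=
  (Finset.univ : Finset (List.Vector σ n)).image List.Vector.toList

lemma mem_words {n : ℕ} {l : List σ} : l ∈ words σ n ↔ l.length = n := by
  simp only [words, Finset.mem_image, Finset.mem_univ, true_and]
  exact ⟨fun ⟨v, hv⟩ => hv ▸ v.toList_length, fun h => ⟨⟨l, h⟩, rfl⟩⟩

lemma card_words (n : ℕ) : (words σ n).card = Fintype.card σ ^ n := by
  rw [words, Finset.card_image_of_injective _ List.Vector.toList_injective, Finset.card_univ,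
    card_vector]

open Classical in
lemma exists_extension_few_bad {F : Finset (List σ)} {n r c : ℕ}
    (hF : ∀ f ∈ F, f.length = n + 1) (hσ : 2 ≤ Fintype.card σ)
    (hr : 2 * F.card < Fintype.card σ ^ r) (hc : F.card * r < 2 ^ c) (hn : r + c ≤ n)
    (hR : ∀ x : List σ, x.length = n → ∃ a b, a ≠ b ∧ x ++ [a] ∉ F ∧ x ++ [b] ∉ F)
    {i : List σ} (hi : i.length = n) :
    ∃ u : List σ, u.length = c ∧
      2 * ((words σ n).filter fun v => ¬ Avoids F (i ++ u ++ v)).card < Fintype.card σ ^ n := by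
  obtain ⟨u, hu, hav, hfree⟩ := exists_free_extension hF hc hn hR hi
  refine ⟨u, hu, ?_⟩
  set b := Fintype.card σ
  let B : Finset (List σ) := F.biUnion fun f => (Finset.Ioc r n).biUnion fun L =>
    (words σ (n - L)).image fun w => f.drop (n + 1 - L) ++ w
  have hsub : ((words σ n).filter fun v => ¬ Avoids F (i ++ u ++ v)) ⊆ B := by
    intro v hv
    rw [Finset.mem_filter, mem_words] at hv
    obtain ⟨hvn, hbad⟩ := hv
    simp only [Avoids, not_forall, not_not] at hbad
    obtain ⟨f, hf, hinf⟩ := hbad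
    have hfl := hF f hf
    rcases infix_append_cases hinf with h | ⟨f₁, f₂, hff, h2, hs, hp⟩
    · exact absurd h (hav f hf)
    have hp' : f₂ <+: v := by
      rcases hp with hp | hp
      · exact hp
      · have := hp.length_le; omega
    have hL1 : 1 ≤ f₂.length := List.length_pos_iff.2 h2
    have hL2 : f₂.length ≤ n := hvn ▸ hp'.length_le
    have hl1 : f₁.length = n + 1 - f₂.length := by
      rw [hff, List.length_append] at hfl; omega
    have hd : f.drop (n + 1 - f₂.length) = f₂ := by rw [hff, ← hl1]; simp
    have ht : f.take (n + 1 - f₂.length) = f₁ := by rw [hff, ← hl1]; simp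
    have hLr : r < f₂.length := by
      by_contra hcon
      exact hfree f hf _ hL1 (not_lt.1 hcon) (ht ▸ hs)
    obtain ⟨w, hw⟩ := hp'
    simp only [B, Finset.mem_biUnion, Finset.mem_image, Finset.mem_Ioc]
    refine ⟨f, hf, f₂.length, ⟨hLr, hL2⟩, w, ?_, by rw [hd, hw]⟩
    rw [mem_words, ← hvn, ← hw]; simp
  have hcard : B.card ≤ F.card * b ^ (n - r) := by
    refine Finset.card_biUnion_le_card_mul _ _ _ fun f _ => ?_
    calc _ ≤ ∑ L ∈ Finset.Ioc r n, b ^ (n - L) := by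
          refine Finset.card_biUnion_le.trans (Finset.sum_le_sum fun L _ => ?_)
          exact Finset.card_image_le.trans (card_words _).le
      _ = ∑ k ∈ (Finset.Ioc r n).image (fun L => n - L), b ^ k := by
          rw [Finset.sum_image]
          intro x hx y hy hxy
          simp only [Finset.coe_Ioc, Set.mem_Ioc] at hx hy hxy
          omega
      _ ≤ b ^ (n - r) := by
          refine (Nat.geomSum_lt hσ fun k hk => ?_).le
          simp only [Finset.mem_image, Finset.mem_Ioc] at hk
          obtain ⟨L, hL, rfl⟩ := hk
          omega
  calc _ ≤ 2 * (F.card * b ^ (n - r)) :=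
        Nat.mul_le_mul_left _ ((Finset.card_le_card hsub).trans hcard)
    _ = 2 * F.card * b ^ (n - r) := by ring
    _ < b ^ r * b ^ (n - r) := Nat.mul_lt_mul_of_pos_right hr (pow_pos (by omega) _)
    _ = b ^ n := by rw [← pow_add]; congr 1; omega

/-- If few words of length `n + 1` are forbidden, and each word of length `n` has two allowed
extensions on either side, then any two words of length `n` can be joined by a word of a fixed
length without creating a forbidden factor. -/
theorem exists_connecting_word {F : Finset (List σ)} {n r c : ℕ}
    (hF : ∀ f ∈ F, f.length = n + 1) (hσ : 2 ≤ Fintype.card σ)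
    (hr : 2 * F.card < Fintype.card σ ^ r) (hc : F.card * r < 2 ^ c) (hn : r + c ≤ n)
    (hR : ∀ x : List σ, x.length = n → ∃ a b, a ≠ b ∧ x ++ [a] ∉ F ∧ x ++ [b] ∉ F)
    (hL : ∀ x : List σ, x.length = n → ∃ a b, a ≠ b ∧ a :: x ∉ F ∧ b :: x ∉ F)
    {i j : List σ} (hi : i.length = n) (hj : j.length = n) :
    ∃ t : List σ, t.length = n + 2 * c ∧ Avoids F (i ++ t ++ j) := by
  classical
  obtain ⟨u, hu, hbad⟩ := exists_extension_few_bad hF hσ hr hc hn hR hi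
  have hcard : (F.image List.reverse).card = F.card :=
    Finset.card_image_of_injective _ List.reverse_injective
  have hmem : ∀ l : List σ, l ∈ F.image List.reverse ↔ l.reverse ∈ F := by
    intro l
    simp only [Finset.mem_image]
    exact ⟨fun ⟨f, hf, h⟩ => by rw [← h]; simpa using hf, fun h => ⟨_, h, by simp⟩⟩
  obtain ⟨u', hu', hbad'⟩ := exists_extension_few_bad (F := F.image List.reverse) (n := n)
    (r := r) (c := c) (i := j.reverse)
    (fun f hf => by simpa using hF _ ((hmem f).1 hf)) hσ (by rwa [hcard]) (by rwa [hcard]) hn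
    (fun x hx => by
      obtain ⟨a, b, hab, h1, h2⟩ := hL x.reverse (by simpa using hx)
      exact ⟨a, b, hab, by simpa [hmem] using h1, by simpa [hmem] using h2⟩)
    (by simpa using hj)
  set B := (words σ n).filter fun v => ¬ Avoids F (i ++ u ++ v)
  set B' := (words σ n).filter
    fun v => ¬ Avoids (F.image List.reverse) (j.reverse ++ u' ++ v)
  have hlt : (B ∪ B'.image List.reverse).card < (words σ n).card := by
    rw [card_words]
    have h1 := Finset.card_union_le B (B'.image List.reverse)
    have h2 : (B'.image List.reverse).card ≤ B'.card := Finset.card_image_le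
    omega
  obtain ⟨v, hv, hvB⟩ := Finset.exists_mem_notMem_of_card_lt_card hlt
  have hvn := mem_words.1 hv
  rw [Finset.mem_union, not_or] at hvB
  have h1 : Avoids F (i ++ u ++ v) := by
    by_contra h
    exact hvB.1 (Finset.mem_filter.2 ⟨hv, h⟩)
  have h2 : Avoids F (v ++ (u'.reverse ++ j)) := by
    by_contra h
    refine hvB.2 (Finset.mem_image.2 ⟨v.reverse, Finset.mem_filter.2 ⟨?_, ?_⟩, by simp⟩)
    · rw [mem_words]; simpa using hvn
    · rw [← avoids_image_reverse] at h
      simpa using h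
  refine ⟨u ++ v ++ u'.reverse, by simp [hu, hu', hvn]; omega, ?_⟩
  intro f hf hinf
  have hfl := hF f hf
  have hinf' : f <:+: (i ++ u ++ v) ++ (u'.reverse ++ j) := by simpa using hinf
  rcases infix_append_cases hinf' with h | ⟨f₁, f₂, hff, hne, hs, hp⟩
  · exact h1 f hf h
  · refine h2 f hf ?_
    rcases hp with hp | hp
    · have hpos := List.length_pos_iff.2 hne
      have hlen : f₁.length ≤ v.length := by
        rw [hff, List.length_append] at hfl; omega
      have hs' := List.suffix_of_suffix_length_le hs (List.suffix_append (i ++ u) v) hlen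
      obtain ⟨p, rfl⟩ := hs'
      obtain ⟨q, hq⟩ := hp
      exact ⟨p, q, by rw [hff, ← hq]; simp⟩
    · exact hp.trans (List.suffix_append _ _).isInfix

end Words

section Interval

variable {x0 len : ℝ} {N : ℕ}

lemma uMap_mem_Icc (hlen : 0 < len) (i : Fin N) {x : ℝ} (hx : x ∈ Set.Icc x0 (x0 + len)) :
    uMap x0 len N i x ∈ Set.Icc x0 (x0 + len) := by
  have hN : (0 : ℝ) < N := by exact_mod_cast i.pos
  have hi : (i : ℝ) + 1 ≤ N := by exact_mod_cast i.isLt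
  have hi0 : (0 : ℝ) ≤ i := by positivity
  obtain ⟨h1, h2⟩ := hx
  have key : ∀ s : ℝ, 0 ≤ s → s ≤ N * len →
      x0 + s / N ∈ Set.Icc x0 (x0 + len) := by
    intro s hs hs'
    have : s / N ≤ len := by rw [div_le_iff₀ hN]; linarith
    have : 0 ≤ s / N := by positivity
    constructor <;> linarith
  unfold uMap
  split_ifs
  · convert key (i * len + (x - x0)) (by nlinarith) (by nlinarith) using 1; ring
  · convert key ((i + 1) * len - (x - x0)) (by nlinarith) (by nlinarith) using 1; ring

lemma abs_uMap_sub (i : Fin N) (x y : ℝ) :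
    |uMap x0 len N i x - uMap x0 len N i y| = |x - y| / N := by
  have h : |x - y| / N = |(x - y) / N| := by rw [abs_div, Nat.abs_cast]
  rw [h]
  unfold uMap
  split_ifs
  · congr 1; ring
  · rw [← abs_neg]; congr 1; ring

lemma mul_uMap_sub (i : Fin N) (x : ℝ) : N * (uMap x0 len N i x - x0) =
    if i.val % 2 = 0 then i * len + (x - x0) else (i + 1) * len - (x - x0) := by
  have hN : (0 : ℝ) < N := by exact_mod_cast i.pos
  unfold uMap
  split_ifs <;> field_simp <;> ring

lemma uMap_injective (i : Fin N) : Function.Injective (uMap x0 len N i) := by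
  intro x y h
  have hN : (N : ℝ) ≠ 0 := by exact_mod_cast i.pos.ne'
  have := abs_uMap_sub (x0 := x0) (len := len) i x y
  rw [h, sub_self, abs_zero, eq_comm, div_eq_zero_iff] at this
  rcases this with h | h
  · exact sub_eq_zero.1 (abs_eq_zero.1 h)
  · exact absurd h hN

lemma exists_uMap_eq (hlen : 0 < len) (hN : 0 < N) {x : ℝ} (hx : x ∈ Set.Icc x0 (x0 + len)) :
    ∃ i : Fin N, ∃ y ∈ Set.Icc x0 (x0 + len), uMap x0 len N i y = x := by
  have hN' : (0 : ℝ) < N := by exact_mod_cast hN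
  obtain ⟨h1, h2⟩ := hx
  obtain ⟨i, hi, hi'⟩ : ∃ i : Fin N, i * len ≤ N * (x - x0) ∧ N * (x - x0) ≤ (i + 1) * len := by
    rcases h2.lt_or_eq with h | h
    · have hs : 0 ≤ N * (x - x0) / len := by
        have : 0 ≤ x - x0 := by linarith
        positivity
      have hlt : N * (x - x0) / len < N := by
        rw [div_lt_iff₀ hlen]; nlinarith
      refine ⟨⟨⌊N * (x - x0) / len⌋₊, (Nat.floor_lt hs).2 hlt⟩, ?_, ?_⟩
      · rw [← le_div_iff₀ hlen]; exact Nat.floor_le hs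
      · rw [← div_le_iff₀ hlen]; exact (Nat.lt_floor_add_one _).le
    · refine ⟨⟨N - 1, by omega⟩, ?_, ?_⟩ <;> subst h <;> push_cast [Nat.cast_sub hN] <;> nlinarith
  refine ⟨i, if i.val % 2 = 0 then x0 + (N * (x - x0) - i * len)
    else x0 + ((i + 1) * len - N * (x - x0)), ?_, ?_⟩
  · split_ifs <;> constructor <;> nlinarith
  · unfold uMap
    split_ifs <;> field_simp <;> ring

/-- Two different subintervals meet only if they are adjacent, and then in a common endpoint. -/
lemma eq_endpoint_of_uMap_eq (hlen : 0 < len) {i i' : Fin N} (hlt : i < i') {y y' : ℝ}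
    (hy : y ∈ Set.Icc x0 (x0 + len)) (hy' : y' ∈ Set.Icc x0 (x0 + len))
    (h : uMap x0 len N i y = uMap x0 len N i' y') :
    i'.val = i.val + 1 ∧ y = y' ∧ (y = x0 ∨ y = x0 + len) := by
  have hN : (0 : ℝ) < N := by exact_mod_cast i.pos
  obtain ⟨h1, h2⟩ := hy
  obtain ⟨h1', h2'⟩ := hy'
  have hle : (i : ℝ) + 1 ≤ i' := by exact_mod_cast hlt
  have e := mul_uMap_sub (x0 := x0) (len := len) i y
  rw [h, mul_uMap_sub] at e
  have hs : i'.val = i.val + 1 := by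
    by_contra hne
    have h3 : (i : ℝ) + 2 ≤ i' := by
      have : i.val < i'.val := hlt
      exact_mod_cast (show i.val + 2 ≤ i'.val by omega)
    split_ifs at e <;> nlinarith
  have hc : (i' : ℝ) = i + 1 := by exact_mod_cast hs
  refine ⟨hs, ?_⟩
  rw [hc] at e
  split_ifs at e
  · omega
  · have : y = x0 := by nlinarith
    exact ⟨by nlinarith, Or.inl this⟩
  · have : y = x0 + len := by nlinarith
    exact ⟨by nlinarith, Or.inr this⟩
  · omega

lemma eq_of_uMap_endpoint (hlen : 0 < len) {i i' : Fin N} {x y y' : ℝ}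
    (hx : x = x0 ∨ x = x0 + len)
    (hy : y ∈ Set.Icc x0 (x0 + len)) (hy' : y' ∈ Set.Icc x0 (x0 + len))
    (h : uMap x0 len N i y = x) (h' : uMap x0 len N i' y' = x) :
    i = i' ∧ y = y' ∧ (y = x0 ∨ y = x0 + len) := by
  have hN : (0 : ℝ) < N := by exact_mod_cast i.pos
  have key : ∀ (k : Fin N) (z : ℝ), z ∈ Set.Icc x0 (x0 + len) → uMap x0 len N k z = x →
      (x = x0 → k.val = 0) ∧ (x = x0 + len → k.val + 1 = N) ∧ (z = x0 ∨ z = x0 + len) := by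
    intro k z ⟨hz1, hz2⟩ hk
    have e := mul_uMap_sub (x0 := x0) (len := len) k z
    rw [hk] at e
    have hk0 : (0 : ℝ) ≤ k := by positivity
    have hk1 : (k : ℝ) + 1 ≤ N := by exact_mod_cast k.isLt
    have hx0 : x = x0 → (k : ℝ) = 0 := by
      intro hx; subst hx
      by_contra hne
      have : (1 : ℝ) ≤ k := by
        have : k.val ≠ 0 := by exact_mod_cast hne
        exact_mod_cast Nat.one_le_iff_ne_zero.2 this
      split_ifs at e <;> nlinarith
    have hx1 : x = x0 + len → (k : ℝ) + 1 = N := by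
      intro hx; subst hx
      by_contra hne
      have : (k : ℝ) + 2 ≤ N := by
        have h1 : k.val + 1 ≠ N := by exact_mod_cast hne
        have h2 := k.isLt
        exact_mod_cast (show k.val + 2 ≤ N by omega)
      split_ifs at e <;> nlinarith
    refine ⟨fun h => by exact_mod_cast hx0 h, fun h => by exact_mod_cast hx1 h, ?_⟩
    rcases hx with hx | hx
    · rw [hx0 hx, hx] at e
      split_ifs at e
      · left; nlinarith
      · right; nlinarith
    · rw [← hx1 hx, hx] at e
      split_ifs at e
      · right; nlinarith
      · left; nlinarith
  have k1 := key i y hy h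
  have k2 := key i' y' hy' h'
  have hii : i = i' := by
    rcases hx with hx | hx
    · exact Fin.ext ((k1.1 hx).trans (k2.1 hx).symm)
    · have := k1.2.1 hx
      have := k2.2.1 hx
      exact Fin.ext (by omega)
  subst hii
  exact ⟨rfl, uMap_injective i (h.trans h'.symm), k1.2.2⟩

/-- The `N`-adic subinterval of `[x0, x0 + len]` addressed by a word. -/
noncomputable def subinterval (x0 len : ℝ) (N : ℕ) : List (Fin N) → Set ℝ
  | [] => Set.Icc x0 (x0 + len)
  | i :: l => uMap x0 len N i '' subinterval x0 len N l

lemma subinterval_subset (hlen : 0 < len) (l : List (Fin N)) :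
    subinterval x0 len N l ⊆ Set.Icc x0 (x0 + len) := by
  induction l with
  | nil => exact subset_rfl
  | cons i l ih =>
    rintro _ ⟨y, hy, rfl⟩
    exact uMap_mem_Icc hlen i (ih hy)

lemma subinterval_endpoint_unique (hlen : 0 < len) {l l' : List (Fin N)}
    (hll : l.length = l'.length) {x : ℝ} (hx : x = x0 ∨ x = x0 + len)
    (h : x ∈ subinterval x0 len N l) (h' : x ∈ subinterval x0 len N l') : l = l' := by
  induction l generalizing l' x with
  | nil => exact (List.length_eq_zero_iff.1 hll.symm).symm
  | cons i l ih =>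
    match l' with
    | [] => simp at hll
    | i' :: l' =>
      obtain ⟨y, hy, hyx⟩ := h
      obtain ⟨y', hy', hyx'⟩ := h'
      obtain ⟨rfl, rfl, he⟩ := eq_of_uMap_endpoint hlen hx (subinterval_subset hlen l hy)
        (subinterval_subset hlen l' hy') hyx hyx'
      rw [ih (by simpa using hll) he hy hy']

lemma subinterval_three (hlen : 0 < len) {l₁ l₂ l₃ : List (Fin N)}
    (h₁₂ : l₁.length = l₂.length) (h₁₃ : l₁.length = l₃.length) {x : ℝ}
    (h₁ : x ∈ subinterval x0 len N l₁) (h₂ : x ∈ subinterval x0 len N l₂)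
    (h₃ : x ∈ subinterval x0 len N l₃) : l₁ = l₂ ∨ l₁ = l₃ ∨ l₂ = l₃ := by
  induction l₁ generalizing l₂ l₃ x with
  | nil => exact Or.inl (List.length_eq_zero_iff.1 h₁₂.symm).symm
  | cons i₁ l₁ ih =>
    match l₂, l₃ with
    | [], _ => simp at h₁₂
    | _, [] => simp at h₁₃
    | i₂ :: l₂, i₃ :: l₃ =>
      simp only [List.length_cons, Nat.add_right_cancel_iff] at h₁₂ h₁₃
      obtain ⟨y₁, hy₁, e₁⟩ := h₁
      obtain ⟨y₂, hy₂, e₂⟩ := h₂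
      obtain ⟨y₃, hy₃, e₃⟩ := h₃
      have m₁ := subinterval_subset hlen l₁ hy₁
      have m₂ := subinterval_subset hlen l₂ hy₂
      have m₃ := subinterval_subset hlen l₃ hy₃
      have adj : ∀ {i i' : Fin N} {y y' : ℝ}, y ∈ Set.Icc x0 (x0 + len) →
          y' ∈ Set.Icc x0 (x0 + len) → uMap x0 len N i y = x → uMap x0 len N i' y' = x →
          i = i' ∨ ((i'.val = i.val + 1 ∨ i.val = i'.val + 1) ∧ y = y' ∧
            (y = x0 ∨ y = x0 + len)) := by
        intro i i' y y' hy hy' h h'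
        rcases lt_trichotomy i i' with hlt | heq | hlt
        · have := eq_endpoint_of_uMap_eq hlen hlt hy hy' (h.trans h'.symm)
          exact Or.inr ⟨Or.inl this.1, this.2⟩
        · exact Or.inl heq
        · have := eq_endpoint_of_uMap_eq hlen hlt hy' hy (h'.trans h.symm)
          exact Or.inr ⟨Or.inr this.1, this.2.1.symm, this.2.1 ▸ this.2.2⟩
      have same : ∀ {i i' : Fin N} {y y' : ℝ} {l l' : List (Fin N)}, i = i' →
          l.length = l'.length → y ∈ subinterval x0 len N l → y' ∈ subinterval x0 len N l' →
          uMap x0 len N i y = x → uMap x0 len N i' y' = x → (y = x0 ∨ y = x0 + len) →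
          i :: l = i' :: l' := by
        intro i i' y y' l l' hi hl hy hy' h h' he
        subst hi
        obtain rfl := uMap_injective i (h.trans h'.symm)
        rw [subinterval_endpoint_unique hlen hl he hy hy']
      rcases adj m₁ m₂ e₁ e₂ with h12 | ⟨h12, hy, he⟩
      · rcases adj m₁ m₃ e₁ e₃ with h13 | ⟨-, -, he⟩
        · subst h12 h13
          obtain rfl := uMap_injective i₁ (e₁.trans e₂.symm)
          obtain rfl := uMap_injective i₁ (e₁.trans e₃.symm)
          simpa using ih h₁₂ h₁₃ hy₁ hy₂ hy₃
        · exact Or.inl (same h12 h₁₂ hy₁ hy₂ e₁ e₂ he)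
      · rcases adj m₁ m₃ e₁ e₃ with h13 | ⟨h13, -, -⟩
        · exact Or.inr (Or.inl (same h13 h₁₃ hy₁ hy₃ e₁ e₃ he))
        · rcases adj m₂ m₃ e₂ e₃ with h23 | ⟨h23, -, -⟩
          · exact Or.inr (Or.inr (same h23 (h₁₂.symm.trans h₁₃) hy₂ hy₃ e₂ e₃ (hy ▸ he)))
          · omega

end Interval

section Square

variable {x0 y0 len : ℝ} {N : ℕ}

lemma Lmap_mem_sqD (hlen : 0 < len) (w : Fin N × Fin N) {t : ℝ × ℝ} (ht : t ∈ sqD x0 y0 len) :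
    Lmap x0 y0 len N w t ∈ sqD x0 y0 len :=
  ⟨uMap_mem_Icc hlen _ ht.1, uMap_mem_Icc hlen _ ht.2⟩

lemma cell_subset_sqD (hlen : 0 < len) (l : List (Fin N × Fin N)) :
    cell x0 y0 len N l ⊆ sqD x0 y0 len := by
  induction l with
  | nil => exact subset_rfl
  | cons w l ih =>
    rintro _ ⟨t, ht, rfl⟩
    exact Lmap_mem_sqD hlen w (ih ht)

lemma dist_Lmap (w : Fin N × Fin N) (s t : ℝ × ℝ) :
    dist (Lmap x0 y0 len N w s) (Lmap x0 y0 len N w t) = dist s t / N := by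
  simp only [Prod.dist_eq, Lmap, Real.dist_eq, abs_uMap_sub]
  exact (max_div_div_right (Nat.cast_nonneg N) _ _)

lemma continuous_Lmap (w : Fin N × Fin N) : Continuous (Lmap x0 y0 len N w) := by
  unfold Lmap uMap
  refine Continuous.prodMk ?_ ?_ <;> split_ifs <;> fun_prop

lemma dist_le_of_mem_cell (l : List (Fin N × Fin N)) {s t : ℝ × ℝ}
    (hs : s ∈ cell x0 y0 len N l) (ht : t ∈ cell x0 y0 len N l) :
    dist s t ≤ len / N ^ l.length := by
  induction l generalizing s t with
  | nil =>
    obtain ⟨⟨h1, h2⟩, h3, h4⟩ := hs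
    obtain ⟨⟨h1', h2'⟩, h3', h4'⟩ := ht
    simp only [List.length_nil, pow_zero, div_one, Prod.dist_eq, Real.dist_eq, max_le_iff, abs_le]
    refine ⟨⟨?_, ?_⟩, ?_, ?_⟩ <;> linarith
  | cons w l ih =>
    obtain ⟨s, hs, rfl⟩ := hs
    obtain ⟨t, ht, rfl⟩ := ht
    rw [dist_Lmap, List.length_cons, pow_succ, ← div_div]
    exact div_le_div_of_nonneg_right (ih hs ht) (Nat.cast_nonneg N)

lemma isCompact_cell (l : List (Fin N × Fin N)) : IsCompact (cell x0 y0 len N l) := by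
  induction l with
  | nil => exact isCompact_Icc.prod isCompact_Icc
  | cons w l ih => exact ih.image (continuous_Lmap w)

lemma cell_nonempty (hlen : 0 < len) (l : List (Fin N × Fin N)) :
    (cell x0 y0 len N l).Nonempty := by
  induction l with
  | nil => exact ⟨(x0, y0), by simp [cell, sqD, hlen.le]⟩
  | cons w l ih => exact ih.image _

lemma exists_mem_cell_concat (hlen : 0 < len) (hN : 0 < N) (l : List (Fin N × Fin N))
    {t : ℝ × ℝ} (ht : t ∈ cell x0 y0 len N l) : ∃ w, t ∈ cell x0 y0 len N (l ++ [w]) := by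
  induction l generalizing t with
  | nil =>
    obtain ⟨i, y, hy, h⟩ := exists_uMap_eq hlen hN ht.1
    obtain ⟨i', y', hy', h'⟩ := exists_uMap_eq hlen hN ht.2
    exact ⟨(i, i'), (y, y'), ⟨hy, hy'⟩, Prod.ext h h'⟩
  | cons v l ih =>
    obtain ⟨s, hs, rfl⟩ := ht
    obtain ⟨w, hw⟩ := ih hs
    exact ⟨w, s, hw, rfl⟩

lemma mem_subinterval_of_mem_cell (l : List (Fin N × Fin N)) {t : ℝ × ℝ}
    (ht : t ∈ cell x0 y0 len N l) :
    t.1 ∈ subinterval x0 len N (l.map Prod.fst) ∧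
      t.2 ∈ subinterval y0 len N (l.map Prod.snd) := by
  induction l generalizing t with
  | nil => exact ht
  | cons w l ih =>
    obtain ⟨s, hs, rfl⟩ := ht
    exact ⟨⟨s.1, (ih hs).1, rfl⟩, ⟨s.2, (ih hs).2, rfl⟩⟩

open Classical in
lemma card_subinterval_le (hlen : 0 < len) (n : ℕ) (x : ℝ) :
    ((words (Fin N) n).filter fun l => x ∈ subinterval x0 len N l).card ≤ 2 := by
  by_contra! h
  obtain ⟨a, ha, b, hb, c, hc, hab, hac, hbc⟩ := Finset.two_lt_card.1 h
  simp only [Finset.mem_filter, mem_words] at ha hb hc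
  rcases subinterval_three hlen (ha.1.trans hb.1.symm) (ha.1.trans hc.1.symm) ha.2 hb.2 hc.2
    with h | h | h <;> contradiction

lemma eq_of_map_fst_eq_of_map_snd_eq {α β : Type*} {l l' : List (α × β)}
    (h₁ : l.map Prod.fst = l'.map Prod.fst) (h₂ : l.map Prod.snd = l'.map Prod.snd) : l = l' := by
  rw [← List.zip_unzip l, ← List.zip_unzip l', List.unzip_eq_map, List.unzip_eq_map, h₁, h₂]

open Classical in
lemma card_cell_le (hlen : 0 < len) (n : ℕ) (t : ℝ × ℝ) :
    ((words (Fin N × Fin N) n).filter fun l => t ∈ cell x0 y0 len N l).card ≤ 4 := by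
  calc _ ≤ (((words (Fin N) n).filter fun l => t.1 ∈ subinterval x0 len N l) ×ˢ
        ((words (Fin N) n).filter fun l => t.2 ∈ subinterval y0 len N l)).card := by
        refine Finset.card_le_card_of_injOn (fun l => (l.map Prod.fst, l.map Prod.snd)) ?_ ?_
        · intro l hl
          simp only [Finset.coe_filter, Set.mem_ofPred_eq, mem_words] at hl
          simpa [mem_words, hl.1] using mem_subinterval_of_mem_cell l hl.2
        · intro l _ l' _ h
          exact eq_of_map_fst_eq_of_map_snd_eq (Prod.ext_iff.1 h).1 (Prod.ext_iff.1 h).2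
    _ ≤ 2 * 2 := by
        rw [Finset.card_product]
        exact Nat.mul_le_mul (card_subinterval_le hlen n _) (card_subinterval_le hlen n _)

open Classical in
/-- The words of length `n` whose cell contains a zero of `S`. -/
noncomputable def zeroWords (x0 y0 len : ℝ) (N : ℕ) (S : ℝ × ℝ → ℝ) (n : ℕ) :
    Finset (List (Fin N × Fin N)) :=
  (words (Fin N × Fin N) n).filter fun l => ∃ z ∈ cell x0 y0 len N l, S z = 0

lemma mem_zeroWords {S : ℝ × ℝ → ℝ} {n : ℕ} {l : List (Fin N × Fin N)} :
    l ∈ zeroWords x0 y0 len N S n ↔ l.length = n ∧ ∃ z ∈ cell x0 y0 len N l, S z = 0 := by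
  simp only [zeroWords, Finset.mem_filter, mem_words]

lemma exists_card_zeroWords_le (hlen : 0 < len) {S : ℝ × ℝ → ℝ}
    (hfin : Set.Finite {t | t ∈ sqD x0 y0 len ∧ S t = 0}) :
    ∃ K, ∀ n, (zeroWords x0 y0 len N S n).card ≤ K := by
  classical
  refine ⟨hfin.toFinset.card * 4, fun n => ?_⟩
  refine le_trans (Finset.card_le_card ?_)
    (Finset.card_biUnion_le_card_mul hfin.toFinset
      (fun z => (words (Fin N × Fin N) n).filter fun l => z ∈ cell x0 y0 len N l) 4
      fun z _ => card_cell_le hlen n z)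
  intro l hl
  obtain ⟨hn, z, hz, hSz⟩ := mem_zeroWords.1 hl
  simp only [Finset.mem_biUnion, Set.Finite.mem_toFinset, Set.mem_ofPred_eq, Finset.mem_filter,
    mem_words]
  exact ⟨z, ⟨cell_subset_sqD hlen l hz, hSz⟩, hn, hz⟩

lemma zeroWords_subset_image_dropLast (hlen : 0 < len) (hN : 0 < N) (S : ℝ × ℝ → ℝ) (n : ℕ) :
    zeroWords x0 y0 len N S n ⊆ (zeroWords x0 y0 len N S (n + 1)).image List.dropLast := by
  intro l hl
  obtain ⟨hn, z, hz, hSz⟩ := mem_zeroWords.1 hl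
  obtain ⟨w, hw⟩ := exists_mem_cell_concat hlen hN l hz
  exact Finset.mem_image.2 ⟨l ++ [w], mem_zeroWords.2 ⟨by simp [hn], z, hw, hSz⟩, by simp⟩

/-- Eventually each cell has at most one subcell of the next level containing a zero. -/
lemma exists_zeroWords_concat_unique (hlen : 0 < len) (hN : 0 < N) {S : ℝ × ℝ → ℝ}
    (hfin : Set.Finite {t | t ∈ sqD x0 y0 len ∧ S t = 0}) :
    ∃ n0, ∀ n ≥ n0, ∀ x a b, x ++ [a] ∈ zeroWords x0 y0 len N S (n + 1) →
      x ++ [b] ∈ zeroWords x0 y0 len N S (n + 1) → a = b := by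
  obtain ⟨K, hK⟩ := exists_card_zeroWords_le (N := N) hlen hfin
  have hsub := zeroWords_subset_image_dropLast (x0 := x0) (y0 := y0) hlen hN S
  have hmono : Monotone fun n => (zeroWords x0 y0 len N S n).card :=
    monotone_nat_of_le_succ fun n => (Finset.card_le_card (hsub n)).trans Finset.card_image_le
  obtain ⟨n0, hn0⟩ : ∃ n0, ∀ n,
      (zeroWords x0 y0 len N S n).card ≤ (zeroWords x0 y0 len N S n0).card := by
    have hbdd : (Set.range fun n => (zeroWords x0 y0 len N S n).card).Finite :=
      (Set.finite_Iic K).subset (by rintro _ ⟨n, rfl⟩; exact hK n)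
    obtain ⟨_, ⟨n0, rfl⟩, h⟩ :=
      Set.exists_max_image _ id hbdd (Set.range_nonempty _)
    exact ⟨n0, fun n => h _ ⟨n, rfl⟩⟩
  refine ⟨n0, fun n hn x a b ha hb => ?_⟩
  have hinj : Set.InjOn List.dropLast
      (↑(zeroWords x0 y0 len N S (n + 1)) : Set (List (Fin N × Fin N))) := by
    rw [← Finset.card_image_iff]
    refine le_antisymm Finset.card_image_le ?_
    exact ((hn0 (n + 1)).trans (hmono hn)).trans (Finset.card_le_card (hsub n))
  have := hinj ha hb (by simp)
  simpa using this

lemma exists_two_notMem {α : Type*} [Fintype α] {p : α → Prop} (hα : 3 ≤ Fintype.card α)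
    (hp : ∀ a b, p a → p b → a = b) : ∃ a b, a ≠ b ∧ ¬ p a ∧ ¬ p b := by
  obtain ⟨a, b, c, hab, hac, hbc⟩ := Fintype.two_lt_card_iff.1 hα
  by_cases ha : p a
  · exact ⟨b, c, hbc, fun h => hab (hp _ _ ha h), fun h => hac (hp _ _ ha h)⟩
  · by_cases hb : p b
    · exact ⟨a, c, hac, ha, fun h => hbc (hp _ _ hb h)⟩
    · exact ⟨a, b, hab, ha, hb⟩

/-- Eventually each cell has at least two preimage cells that avoid the zeros of `S`. -/
lemma exists_two_cons_notMem_zeroWords (hlen : 0 < len) (hN : 2 ≤ N) {S : ℝ × ℝ → ℝ}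
    (hS : ContinuousOn S (sqD x0 y0 len)) (hS1 : ∀ t ∈ sqD x0 y0 len, |S t| < 1)
    (hgamma : ∀ t ∈ sqD x0 y0 len, 1 ≤ ∑ w : Fin N × Fin N, |S (Lmap x0 y0 len N w t)|) :
    ∃ n0, ∀ n ≥ n0, ∀ x : List (Fin N × Fin N), x.length = n → ∃ a b, a ≠ b ∧
      a :: x ∉ zeroWords x0 y0 len N S (n + 1) ∧ b :: x ∉ zeroWords x0 y0 len N S (n + 1) := by
  have hcomp : IsCompact (sqD x0 y0 len) := isCompact_cell (N := N) []
  obtain ⟨p, hp, hmax⟩ := hcomp.exists_isMaxOn (cell_nonempty (N := N) hlen []) hS.abs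
  have hNpos : (0 : ℝ) < N := by exact_mod_cast (by omega : 0 < N)
  set C : ℝ := ((Fintype.card (Fin N × Fin N) : ℕ) : ℝ)
  have hC : 0 < C := by simp only [C, Fintype.card_prod, Fintype.card_fin]; push_cast; positivity
  have hgap : 0 < 1 - |S p| := by linarith [hS1 p hp]
  obtain ⟨δ, hδ, huc⟩ := Metric.uniformContinuousOn_iff.1
    (hcomp.uniformContinuousOn_of_continuous hS) ((1 - |S p|) / C) (by positivity)
  have hlim : Filter.Tendsto (fun n : ℕ => len / (N : ℝ) ^ n) Filter.atTop (nhds 0) :=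
    tendsto_const_nhds.div_atTop
      (tendsto_pow_atTop_atTop_of_one_lt (by exact_mod_cast (by omega : 1 < N)))
  obtain ⟨n0, hn0⟩ := Filter.eventually_atTop.1 (hlim.eventually (gt_mem_nhds hδ))
  refine ⟨n0, fun n hn x hx => ?_⟩
  obtain ⟨t, ht⟩ := cell_nonempty (x0 := x0) (y0 := y0) hlen x
  have htD := cell_subset_sqD hlen x ht
  have hsmall : ∀ w, w :: x ∈ zeroWords x0 y0 len N S (n + 1) →
      |S (Lmap x0 y0 len N w t)| < (1 - |S p|) / C := by
    intro w hw
    obtain ⟨-, z, hz, hSz⟩ := mem_zeroWords.1 hw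
    have hd : dist (Lmap x0 y0 len N w t) z < δ := by
      refine (dist_le_of_mem_cell (w :: x) ⟨t, ht, rfl⟩ hz).trans_lt (hn0 _ ?_)
      simp only [List.length_cons, hx]; omega
    have := huc _ (Lmap_mem_sqD hlen w htD) z (cell_subset_sqD hlen _ hz) hd
    rwa [hSz, Real.dist_eq, sub_zero] at this
  by_contra! hcon
  obtain ⟨a, ha⟩ : ∃ a, ∀ w ≠ a, w :: x ∈ zeroWords x0 y0 len N S (n + 1) := by
    by_cases h : ∃ a, a :: x ∉ zeroWords x0 y0 len N S (n + 1)
    · obtain ⟨a, ha⟩ := h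
      exact ⟨a, fun w hw => hcon a w hw.symm ha⟩
    · push Not at h
      exact ⟨(⟨0, by omega⟩, ⟨0, by omega⟩), fun w _ => h w⟩
  have hlt : ∑ w : Fin N × Fin N, |S (Lmap x0 y0 len N w t)| < 1 := by
    rw [← Finset.add_sum_erase _ _ (Finset.mem_univ a)]
    have h1 : |S (Lmap x0 y0 len N a t)| ≤ |S p| := hmax (Lmap_mem_sqD hlen a htD)
    have h2 : ∑ w ∈ Finset.univ.erase a, |S (Lmap x0 y0 len N w t)| ≤
        ((Finset.univ.erase a : Finset (Fin N × Fin N)).card) * ((1 - |S p|) / C) := by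
      rw [← nsmul_eq_mul]
      exact Finset.sum_le_card_nsmul _ _ _ fun w hw =>
        (hsmall w (ha w (Finset.ne_of_mem_erase hw))).le
    have h3 : ((Finset.univ.erase a : Finset (Fin N × Fin N)).card : ℝ) < C := by
      simp only [C, Nat.cast_lt]
      exact Finset.card_erase_lt_of_mem (Finset.mem_univ a)
    have h4 : ((Finset.univ.erase a : Finset (Fin N × Fin N)).card : ℝ) * ((1 - |S p|) / C) <
        C * ((1 - |S p|) / C) := mul_lt_mul_of_pos_right h3 (by positivity)
    rw [mul_div_cancel₀ _ hC.ne'] at h4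
    linarith
  exact absurd (hgamma t htD) (not_le.2 hlt)

lemma infAbs_cell_pos (hlen : 0 < len) {S : ℝ × ℝ → ℝ} (hS : ContinuousOn S (sqD x0 y0 len))
    {l : List (Fin N × Fin N)} (hl : ∀ z ∈ cell x0 y0 len N l, S z ≠ 0) :
    0 < infAbs S (cell x0 y0 len N l) := by
  obtain ⟨p, hp, h⟩ := (isCompact_cell l).exists_sInf_image_eq (cell_nonempty hlen l)
    (hS.mono (cell_subset_sqD hlen l)).abs
  rw [infAbs, h]
  exact abs_pos.2 (hl p hp)

lemma lowMat_nonneg (S : ℝ × ℝ → ℝ) (m : ℕ) (i j) : 0 ≤ lowMat x0 y0 len N S m i j := by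
  unfold lowMat
  split_ifs
  · exact Real.sInf_nonneg (by rintro _ ⟨t, -, rfl⟩; exact abs_nonneg _)
  · exact le_rfl

lemma lowMat_pow_pos (hlen : 0 < len) {S : ℝ × ℝ → ℝ} (hS : ContinuousOn S (sqD x0 y0 len))
    {m : ℕ} (i j : Fin (m + 1) → Fin N × Fin N) (s t : List (Fin N × Fin N))
    (hst : List.ofFn i ++ t = s ++ List.ofFn j)
    (hav : Avoids (zeroWords x0 y0 len N S (m + 2)) (List.ofFn i ++ t)) :
    0 < (lowMat x0 y0 len N S m ^ t.length) i j := by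
  induction t generalizing i s with
  | nil =>
    have hs : s = [] := by
      have := congrArg List.length hst
      simpa using this
    subst hs
    have : i = j := List.ofFn_injective (by simpa using hst)
    subst this
    simp
  | cons a t ih =>
    match s with
    | [] =>
      have := congrArg List.length hst
      simp at this
    | b :: s =>
      let i' : Fin (m + 1) → Fin N × Fin N := Fin.snoc (fun k : Fin m => i k.succ) a
      have hi' : List.ofFn i ++ [a] = i 0 :: List.ofFn i' := by
        rw [List.ofFn_succ, List.ofFn_succ' i']
        simp [i']
      have hsplit : List.ofFn i ++ a :: t = i 0 :: (List.ofFn i' ++ t) := by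
        rw [List.append_cons, hi', List.cons_append]
      rw [hsplit, List.cons_append, List.cons.injEq] at hst
      have htail := ih i' s hst.2 fun f hf h =>
        hav f hf (by rw [hsplit]; exact h.trans (List.suffix_cons _ _).isInfix)
      have hhead : 0 < lowMat x0 y0 len N S m i i' := by
        unfold lowMat
        rw [if_pos fun k => by simp [i']]
        refine infAbs_cell_pos hlen hS fun z hz hSz => ?_
        have ha : i' (Fin.last m) = a := by simp [i']
        rw [ha] at hz
        refine hav (List.ofFn i ++ [a]) (mem_zeroWords.2 ⟨by simp, z, hz, hSz⟩) ?_
        exact List.IsPrefix.isInfix ⟨t, by simp⟩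
      have hnonneg : ∀ k i j, 0 ≤ (lowMat x0 y0 len N S m ^ k) i j := by
        intro k
        induction k with
        | zero => intro i j; rw [pow_zero, Matrix.one_apply]; split_ifs <;> norm_num
        | succ k ihk =>
          intro i j
          rw [pow_succ, Matrix.mul_apply]
          exact Finset.sum_nonneg fun k _ => mul_nonneg (ihk i k) (lowMat_nonneg S m k j)
      rw [List.length_cons, pow_succ', Matrix.mul_apply]
      exact Finset.sum_pos' (fun k _ => mul_nonneg (lowMat_nonneg S m i k) (hnonneg _ k j))
        ⟨i', Finset.mem_univ _, mul_pos hhead htail⟩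

end Square

/-- if γ_* ≥ 1 and S has finitely many zeros, the lower vertical scaling
matrices are eventually primitive (level n corresponds to m+1). -/
theorem lowMat_eventually_primitive (x0 y0 len : ℝ) (hlen : 0 < len) (N : ℕ) (hN : 2 ≤ N)
    (S : ℝ × ℝ → ℝ) (hS : ContinuousOn S (sqD x0 y0 len))
    (hS1 : ∀ t ∈ sqD x0 y0 len, |S t| < 1)
    (hfin : Set.Finite {t | t ∈ sqD x0 y0 len ∧ S t = 0})
    (hgamma : ∀ t ∈ sqD x0 y0 len, 1 ≤ ∑ w : Fin N × Fin N, |S (Lmap x0 y0 len N w t)|) :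
    ∃ n0 : ℕ, ∀ m : ℕ, n0 < m + 1 → MatPrimitive (lowMat x0 y0 len N S m) := by
  obtain ⟨K, hK⟩ := exists_card_zeroWords_le (N := N) hlen hfin
  obtain ⟨n1, h1⟩ := exists_zeroWords_concat_unique (N := N) hlen (by omega) hfin
  obtain ⟨n2, h2⟩ := exists_two_cons_notMem_zeroWords hlen hN hS hS1 hgamma
  have hcard : 4 ≤ Fintype.card (Fin N × Fin N) := by
    rw [Fintype.card_prod, Fintype.card_fin]; nlinarith
  set r := 2 * K
  set c := K * r
  refine ⟨n1 + n2 + r + c, fun m hm => ?_⟩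
  set F := zeroWords x0 y0 len N S (m + 2)
  have hFK : F.card ≤ K := hK _
  have hr : 2 * F.card < Fintype.card (Fin N × Fin N) ^ r :=
    calc 2 * F.card ≤ r := Nat.mul_le_mul_left 2 hFK
      _ < _ := Nat.lt_pow_self (by omega)
  have hc : F.card * r < 2 ^ c :=
    (Nat.mul_le_mul_right r hFK).trans_lt (Nat.lt_pow_self (by norm_num))
  refine ⟨(m + 1) + 2 * c + (m + 1), by omega, fun i j => ?_⟩
  obtain ⟨t, ht, hav⟩ := exists_connecting_word (F := F) (n := m + 1)
    (fun f hf => (mem_zeroWords.1 hf).1) (by omega) hr hc (by omega)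
    (fun x _ => exists_two_notMem (p := fun a => x ++ [a] ∈ F) (by omega)
      (h1 (m + 1) (by omega) x))
    (h2 (m + 1) (by omega)) (i := List.ofFn i) (j := List.ofFn j) (by simp) (by simp)
  have := lowMat_pow_pos hlen hS i j (List.ofFn i ++ t) (t ++ List.ofFn j) (by simp)
    (by rwa [← List.append_assoc])
  rwa [List.length_append, ht, List.length_ofFn] at this
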